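/- arXiv:1406.0200 — 2 statements merged into one kernel-verified Lean document; each statement's English description precedes it below -/
import Mathlib

section
/- Suppose 1 ≤ k < L and j* is an index with k + 1 < j* ≤ L such that D_{k j*} > D_{k j} for every j with k < j ≤ L and j ≠ j*. Then for every m with k < m < j*, the decision region of x_m is empty: there is no real Z satisfying max_{j : m < j ≤ L} D_{m j} < Z < min_{j : 1 ≤ j < m} D_{m j}. In particular the symbol x_m is never selected by the slicer, regardless of the value of the decision statistic. -/
/-- The probabilistic boundary between constellation symbols `x k` and `x j`. -/
noncomputable def probBoundary (x P : ℕ → ℝ) (h : ℝ) (k j : ℕ) : ℝ :=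
  (x k + x j) / 2 - Real.log (P k / P j) / (2 * (x k - x j) * h)

/-- The probabilistic boundary is the slope of the chord of `i ↦ x i ^ 2 / 2 - log (P i) / (2 * h)`
over the symbols. -/
lemma probBoundary_mul_sub {x P : ℕ → ℝ} {h : ℝ} {k j : ℕ} (hh : h ≠ 0) (hx : x k - x j ≠ 0)
    (hk : P k ≠ 0) (hj : P j ≠ 0) :
    probBoundary x P h k j * (x k - x j) =
      (x k ^ 2 / 2 - Real.log (P k) / (2 * h)) - (x j ^ 2 / 2 - Real.log (P j) / (2 * h)) := by
  rw [probBoundary, Real.log_div hk hj]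
  field_simp
  ring

/-- If the boundary of the outer symbols `k`, `l` exceeds that of `k` and an intermediate symbol
`m`, then the boundary of `m` and `l` exceeds that of `m` and `k`. -/
lemma probBoundary_lt_of_lt {x P : ℕ → ℝ} {h : ℝ} {k m l : ℕ} (hh : h ≠ 0)
    (hkm : x m < x k) (hml : x l < x m) (hk : P k ≠ 0) (hm : P m ≠ 0) (hl : P l ≠ 0)
    (hlt : probBoundary x P h k m < probBoundary x P h k l) :
    probBoundary x P h m k < probBoundary x P h m l := by
  have e₁ := probBoundary_mul_sub hh (sub_pos.2 hkm).ne' hk hm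
  have e₂ := probBoundary_mul_sub hh (sub_pos.2 (hml.trans hkm)).ne' hk hl
  have e₃ := probBoundary_mul_sub hh (sub_pos.2 hml).ne' hm hl
  have e₄ := probBoundary_mul_sub hh (sub_neg.2 hkm).ne hm hk
  have hsymm : probBoundary x P h m k = probBoundary x P h k m :=
    mul_right_cancel₀ (sub_pos.2 hkm).ne' (by linarith)
  rw [hsymm]
  refine lt_of_mul_lt_mul_right ?_ (sub_pos.2 hml).le
  have := mul_lt_mul_of_pos_right hlt (sub_pos.2 (hml.trans hkm))
  linarith

theorem empty_decision_region_of_skipped_symbol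
    (L : ℕ) (hL : 2 ≤ L) (d : ℝ) (hd : 0 < d)
    (x P : ℕ → ℝ)
    (hx : ∀ k j, 1 ≤ k → k ≤ L → 1 ≤ j → j ≤ L → x k - x j = ((j : ℝ) - (k : ℝ)) * d)
    (hP : ∀ k, 1 ≤ k → k ≤ L → 0 < P k)
    (h : ℝ) (hh : 0 < h)
    (k jstar : ℕ) (hk1 : 1 ≤ k) (hkL : k < L)
    (hjs : k + 1 < jstar) (hjsL : jstar ≤ L)
    (hmax : ∀ j, k < j → j ≤ L → j ≠ jstar →
      probBoundary x P h k j < probBoundary x P h k jstar) :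
    ∀ m, k < m → m < jstar →
      ¬ ∃ Z : ℝ,
        (∀ j, m < j → j ≤ L → probBoundary x P h m j < Z) ∧
        (∀ j, 1 ≤ j → j < m → Z < probBoundary x P h m j) := by
  rintro m hkm hmj ⟨Z, hlow, hupp⟩
  have hlt : ∀ i j, 1 ≤ i → i < j → j ≤ L → x j < x i := fun i j hi hij hj ↦ by
    have hpos : 0 < ((j : ℝ) - i) * d := mul_pos (sub_pos.2 (Nat.cast_lt.2 hij)) hd
    linarith [hx i j hi (by omega) (by omega) hj]
  have hmk := probBoundary_lt_of_lt hh.ne' (hlt k m hk1 hkm (by omega))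
    (hlt m jstar (by omega) hmj hjsL) (hP k hk1 hkL.le).ne' (hP m (by omega) (by omega)).ne'
    (hP jstar (by omega) hjsL).ne' (hmax m hkm (by omega) hmj.ne)
  exact lt_asymm hmk ((hlow jstar hmj hjsL).trans (hupp k hk1 hkm))
end

section
/- For every real Z: the symbol x_1 is the strict maximizer of the MAP slicer metric (μ_1(Z) > μ_j(Z) for all j ≠ 1) if and only if Z > max_{j : 1 < j ≤ L} D_{1 j}; and the symbol x_L is the strict maximizer (μ_L(Z) > μ_j(Z) for all j ≠ L) if and only if Z < min_{j : 1 ≤ j < L} D_{L j}. -/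
/-- The MAP slicer metric of symbol `x j` at decision statistic `Z`. -/
noncomputable def slicerMetric (x P : ℕ → ℝ) (h : ℝ) (j : ℕ) (Z : ℝ) : ℝ :=
  Real.log (P j) / h - (Z - x j) ^ 2

theorem slicerMetric_sub_slicerMetric {x P : ℕ → ℝ} {h : ℝ} {k j : ℕ} (Z : ℝ)
    (hh : h ≠ 0) (hk : P k ≠ 0) (hj : P j ≠ 0) (hkj : x k - x j ≠ 0) :
    slicerMetric x P h k Z - slicerMetric x P h j Z =
      2 * (x k - x j) * (Z - probBoundary x P h k j) := by
  unfold slicerMetric probBoundary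
  rw [Real.log_div hk hj]
  field_simp
  ring

theorem slicerMetric_lt_iff_of_lt {x P : ℕ → ℝ} {h : ℝ} {k j : ℕ} (Z : ℝ)
    (hh : h ≠ 0) (hk : P k ≠ 0) (hj : P j ≠ 0) (hjk : x j < x k) :
    slicerMetric x P h j Z < slicerMetric x P h k Z ↔ probBoundary x P h k j < Z := by
  have hpos : 0 < 2 * (x k - x j) := by linarith
  rw [← sub_pos, slicerMetric_sub_slicerMetric Z hh hk hj (sub_pos.2 hjk).ne',
    mul_pos_iff_of_pos_left hpos, sub_pos]

theorem slicerMetric_lt_iff_of_gt {x P : ℕ → ℝ} {h : ℝ} {k j : ℕ} (Z : ℝ)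
    (hh : h ≠ 0) (hk : P k ≠ 0) (hj : P j ≠ 0) (hkj : x k < x j) :
    slicerMetric x P h j Z < slicerMetric x P h k Z ↔ Z < probBoundary x P h k j := by
  have hneg : 2 * (x k - x j) < 0 := by linarith
  rw [← sub_pos, slicerMetric_sub_slicerMetric Z hh hk hj (sub_neg.2 hkj).ne,
    ← sub_neg (a := Z)]
  exact ⟨(neg_of_mul_pos_right · hneg.le), mul_pos_of_neg_of_neg hneg⟩

theorem edge_decision_regions_iff
    (L : ℕ) (hL : 2 ≤ L) (d : ℝ) (hd : 0 < d)
    (x P : ℕ → ℝ)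
    (hx : ∀ k j, 1 ≤ k → k ≤ L → 1 ≤ j → j ≤ L → x k - x j = ((j : ℝ) - (k : ℝ)) * d)
    (hP : ∀ k, 1 ≤ k → k ≤ L → 0 < P k)
    (h : ℝ) (hh : 0 < h) (Z : ℝ) :
    ((∀ j, 1 ≤ j → j ≤ L → j ≠ 1 → slicerMetric x P h 1 Z > slicerMetric x P h j Z) ↔
       (∀ j, 1 < j → j ≤ L → probBoundary x P h 1 j < Z)) ∧
    ((∀ j, 1 ≤ j → j ≤ L → j ≠ L → slicerMetric x P h L Z > slicerMetric x P h j Z) ↔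
       (∀ j, 1 ≤ j → j < L → Z < probBoundary x P h L j)) := by
  have hanti : ∀ k j, 1 ≤ k → k < j → j ≤ L → x j < x k := fun k j hk hkj hj ↦ by
    rw [← sub_pos, hx k j hk (by omega) (by omega) hj]
    exact mul_pos (sub_pos.2 (Nat.cast_lt.2 hkj)) hd
  have hne : ∀ k, 1 ≤ k → k ≤ L → P k ≠ 0 := fun k h1 h2 ↦ (hP k h1 h2).ne'
  have hfirst : ∀ j, 1 < j → j ≤ L →
      (slicerMetric x P h j Z < slicerMetric x P h 1 Z ↔ probBoundary x P h 1 j < Z) :=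
    fun j h1 h2 ↦ slicerMetric_lt_iff_of_lt Z hh.ne' (hne 1 le_rfl (by omega))
      (hne j h1.le h2) (hanti 1 j le_rfl h1 h2)
  have hlast : ∀ j, 1 ≤ j → j < L →
      (slicerMetric x P h j Z < slicerMetric x P h L Z ↔ Z < probBoundary x P h L j) :=
    fun j h1 h2 ↦ slicerMetric_lt_iff_of_gt Z hh.ne' (hne L (by omega) le_rfl)
      (hne j h1 h2.le) (hanti j L h1 h2 le_rfl)
  refine ⟨⟨fun H j h1 h2 ↦ ?_, fun H j h1 h2 h3 ↦ ?_⟩,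
    ⟨fun H j h1 h2 ↦ ?_, fun H j h1 h2 h3 ↦ ?_⟩⟩
  · exact (hfirst j h1 h2).1 (H j h1.le h2 h1.ne')
  · exact (hfirst j (by omega) h2).2 (H j (by omega) h2)
  · exact (hlast j h1 h2).1 (H j h1 h2.le h2.ne)
  · exact (hlast j h1 (by omega)).2 (H j h1 (by omega))
end
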